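/- arXiv:1507.04330 — 2 statements merged into one kernel-verified Lean document; each statement's English description precedes it below -/
import Mathlib

section
/- Let G_old and G_new be finite simple graphs that differ by exactly one vertex v* (either G_new is G_old with v* and its incident edges removed, or G_new is G_old with the new vertex v* and some edges from v* added). Then the expectation, over a uniformly random linear order π on the larger vertex set, of the size of the influenced set satisfies E_π[|S(G_old,G_new,π)|] ≤ 1. -/
open scoped Classical

noncomputable section

variable {V : Type*}

/-- The MIS invariant: `v ∈ M` iff no earlier neighbor of `v` is in `M`. -/
def misInv (G : SimpleGraph V) (π : V → ℕ) (M : Set V) : Prop :=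
  ∀ v, v ∈ M ↔ ∀ u, G.Adj u v → π u < π v → u ∉ M

/-- Membership in the greedy MIS of `G` under the order `π`. -/
def greedy (G : SimpleGraph V) (π : V → ℕ) (v : V) : Prop :=
  ∀ u, G.Adj u v → ∀ _hlt : π u < π v, ¬ greedy G π u
termination_by π v

/-- The greedy MIS of `G` under the order `π`. -/
def greedySet (G : SimpleGraph V) (π : V → ℕ) : Set V := {v | greedy G π v}

/-- The MIS invariant holds at vertex `v` for states `M`. -/
def invAt (G : SimpleGraph V) (M : Set V) (π : V → ℕ) (v : V) : Prop :=
  v ∈ M ↔ ∀ u, G.Adj u v → π u < π v → u ∉ M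

/-- `I_π(u)`: neighbors of `u` preceding `u` in `π`. -/
def Iset (G : SimpleGraph V) (π : V → ℕ) (u : V) : Set V :=
  {w | G.Adj w u ∧ π w < π u}

/-- The layers `S_i` of the influenced set. -/
def Slayer (H : SimpleGraph V) (M : Set V) (π : V → ℕ) (v0 : V) : ℕ → Set V
  | 0 => {v0}
  | i + 1 =>
      {u | u ∈ M ∧ ∃ w ∈ Slayer H M π v0 i, w ∈ Iset H π u} ∪
      {u | u ∉ M ∧ ∀ w ∈ Iset H π u, w ∈ M → ∃ j, ∃ _hj : j ≤ i, w ∈ Slayer H M π v0 j}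
decreasing_by all_goals omega

/-- The union of all layers. -/
def Sunion (H : SimpleGraph V) (M : Set V) (π : V → ℕ) (v0 : V) : Set V :=
  ⋃ i, Slayer H M π v0 i

/-- The influenced set: empty when the invariant is not `broken` at `v0`. -/
def Sinfl (H : SimpleGraph V) (M : Set V) (π : V → ℕ) (v0 : V) (broken : Prop) : Set V :=
  if broken then Sunion H M π v0 else ∅

/-- The order obtained from `π` by moving `v0` to be first. -/
def pushFirst (π : V → ℕ) (v0 : V) : V → ℕ :=
  fun v => if v = v0 then 0 else π v + 1

/-- The ℕ-valued order attached to a uniformly random bijection `V ≃ Fin |V|`. -/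
def toOrd [Fintype V] (π : V ≃ Fin (Fintype.card V)) : V → ℕ := fun v => (π v : ℕ)

/-- `π` and `σ` induce the same relative order on `A`. -/
def sameOrderOn (π σ : V → ℕ) (A : Set V) : Prop :=
  ∀ x ∈ A, ∀ y ∈ A, (π x < π y ↔ σ x < σ y)


theorem mem_Slayer_zero {H : SimpleGraph V} {M : Set V} {π : V → ℕ} {v u : V} :
    u ∈ Slayer H M π v 0 ↔ u = v := by
  rw [Slayer]; rfl

theorem mem_Slayer_succ {H : SimpleGraph V} {M : Set V} {π : V → ℕ} {v u : V} {i : ℕ} :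
    u ∈ Slayer H M π v (i + 1) ↔ (u ∈ M ∧ ∃ w ∈ Slayer H M π v i, w ∈ Iset H π u) ∨
      (u ∉ M ∧ ∀ w ∈ Iset H π u, w ∈ M → ∃ j ≤ i, w ∈ Slayer H M π v j) := by
  rw [Slayer]
  simp only [Set.mem_union, Set.mem_ofPred_eq, exists_prop]

theorem self_mem_Sunion (H : SimpleGraph V) (M : Set V) (π : V → ℕ) (v : V) :
    v ∈ Sunion H M π v :=
  Set.mem_iUnion.2 ⟨0, mem_Slayer_zero.2 rfl⟩

/-- `Sunion` is contained in every set that contains `v` and is closed under the layer rules. -/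
theorem Sunion_subset {H : SimpleGraph V} {M : Set V} {π : V → ℕ} {v : V} {T : Set V}
    (hv : v ∈ T) (hmem : ∀ u ∈ M, ∀ w ∈ T, w ∈ Iset H π u → u ∈ T)
    (hnot : ∀ u ∉ M, (∀ w ∈ Iset H π u, w ∈ M → w ∈ T) → u ∈ T) :
    Sunion H M π v ⊆ T := by
  have key : ∀ i, ∀ u ∈ Slayer H M π v i, u ∈ T := by
    intro i
    induction i using Nat.strong_induction_on with
    | _ i ih =>
      intro u hu
      cases i with
      | zero => rwa [mem_Slayer_zero.1 hu]
      | succ i =>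
        rcases mem_Slayer_succ.1 hu with ⟨huM, w, hw, hwu⟩ | ⟨huM, h⟩
        · exact hmem u huM w (ih i (by omega) w hw) hwu
        · refine hnot u huM fun w hw hwM => ?_
          obtain ⟨j, hj, hwj⟩ := h w hw hwM
          exact ih j (by omega) w hwj
  intro u hu
  obtain ⟨i, hi⟩ := Set.mem_iUnion.1 hu
  exact key i u hi

theorem mem_Sunion_of_mem {H : SimpleGraph V} {M : Set V} {π : V → ℕ} {v u w : V}
    (hu : u ∈ M) (hw : w ∈ Sunion H M π v) (hwu : w ∈ Iset H π u) : u ∈ Sunion H M π v := by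
  obtain ⟨i, hi⟩ := Set.mem_iUnion.1 hw
  exact Set.mem_iUnion.2 ⟨i + 1, mem_Slayer_succ.2 (Or.inl ⟨hu, w, hi, hwu⟩)⟩

theorem mem_Sunion_of_notMem [Finite V] {H : SimpleGraph V} {M : Set V} {π : V → ℕ} {v u : V}
    (hu : u ∉ M) (h : ∀ w ∈ Iset H π u, w ∈ M → w ∈ Sunion H M π v) :
    u ∈ Sunion H M π v := by
  have := Fintype.ofFinite V
  have hl : ∀ w, ∃ i, w ∈ Sunion H M π v → w ∈ Slayer H M π v i := by
    intro w
    by_cases hw : w ∈ Sunion H M π v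
    · obtain ⟨i, hi⟩ := Set.mem_iUnion.1 hw
      exact ⟨i, fun _ => hi⟩
    · exact ⟨0, fun h => absurd h hw⟩
  choose f hf using hl
  refine Set.mem_iUnion.2 ⟨Finset.univ.sup f + 1, mem_Slayer_succ.2 (Or.inr ⟨hu, ?_⟩)⟩
  exact fun w hw hwM => ⟨f w, Finset.le_sup (Finset.mem_univ w), hf w (h w hw hwM)⟩

theorem mem_Sunion_cases {H : SimpleGraph V} {M : Set V} {π : V → ℕ} {v u : V}
    (hu : u ∈ Sunion H M π v) :
    u = v ∨ (u ∈ M ∧ ∃ w ∈ Sunion H M π v, w ∈ Iset H π u) ∨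
      (u ∉ M ∧ ∀ w ∈ Iset H π u, w ∈ M → w ∈ Sunion H M π v) := by
  obtain ⟨i, hi⟩ := Set.mem_iUnion.1 hu
  cases i with
  | zero => exact Or.inl (mem_Slayer_zero.1 hi)
  | succ i =>
    rcases mem_Slayer_succ.1 hi with ⟨huM, w, hw, hwu⟩ | ⟨huM, h⟩
    · exact Or.inr (Or.inl ⟨huM, w, Set.mem_iUnion.2 ⟨i, hw⟩, hwu⟩)
    · refine Or.inr (Or.inr ⟨huM, fun w hw hwM => ?_⟩)
      obtain ⟨j, -, hj⟩ := h w hw hwM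
      exact Set.mem_iUnion.2 ⟨j, hj⟩

/-- The MIS invariant holds at every vertex other than `v`. -/
def invOff (H : SimpleGraph V) (π : V → ℕ) (v : V) (M : Set V) : Prop :=
  ∀ u, u ≠ v → invAt H M π u

theorem invOff.mem_iff {H : SimpleGraph V} {π : V → ℕ} {v u : V} {M : Set V}
    (hM : invOff H π v M) (hu : u ≠ v) : u ∈ M ↔ ∀ w, H.Adj w u → π w < π u → w ∉ M :=
  hM u hu

theorem invOff.unique {H : SimpleGraph V} {π : V → ℕ} {v : V} {M N : Set V}
    (hM : invOff H π v M) (hN : invOff H π v N) (hv : v ∈ M ↔ v ∈ N) : M = N := by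
  have key : ∀ n u, π u = n → (u ∈ M ↔ u ∈ N) := by
    intro n
    induction n using Nat.strong_induction_on with
    | _ n ih =>
      rintro u rfl
      by_cases huv : u = v
      · rwa [huv]
      · rw [hM.mem_iff huv, hN.mem_iff huv]
        exact forall_congr' fun w => forall_congr' fun _ => forall_congr' fun hlt =>
          not_congr (ih (π w) hlt w rfl)
  ext u
  exact key _ u rfl

/-- A state outside the influenced set has no neighbors inside it. -/
theorem invOff.notMem_Sunion_of_adj {H : SimpleGraph V} {ρ : V → ℕ} {v : V} {M : Set V}
    (hM : invOff H ρ v M) (hinj : Function.Injective ρ) (hfirst : ∀ w ≠ v, ρ v < ρ w)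
    {u w : V} (hwM : w ∈ M) (hw : w ∉ Sunion H M ρ v) (hadj : H.Adj u w) :
    u ∉ Sunion H M ρ v := by
  intro hu
  have hwv : w ≠ v := fun h => hw (h ▸ self_mem_Sunion H M ρ v)
  rcases lt_trichotomy (ρ u) (ρ w) with h | h | h
  · exact hw (mem_Sunion_of_mem hwM hu ⟨hadj, h⟩)
  · exact hadj.ne (hinj h)
  · have huv : u ≠ v := fun e => by
      have := hfirst w hwv
      rw [e] at h
      omega
    have huM : u ∉ M := fun huM => (hM.mem_iff huv).1 huM w hadj.symm h hwM
    rcases mem_Sunion_cases hu with e | ⟨h', -⟩ | ⟨-, h'⟩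
    · exact huv e
    · exact huM h'
    · exact hw (h' w ⟨hadj.symm, h⟩ hwM)

/-- Interleaving the influenced set differently with its complement changes neither the states
nor the influenced set. -/
theorem invOff.reorder [Finite V] {H : SimpleGraph V} {ρ ρ' : V → ℕ} {v : V} {M : Set V}
    (hM : invOff H ρ v M) (hinj : Function.Injective ρ) (hfirst : ∀ w ≠ v, ρ v < ρ w)
    (hin : sameOrderOn ρ ρ' (Sunion H M ρ v)) (hout : sameOrderOn ρ ρ' (Sunion H M ρ v)ᶜ) :
    invOff H ρ' v M ∧ Sunion H M ρ' v = Sunion H M ρ v := by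
  have hno : ∀ {u w : V}, w ∈ M → H.Adj w u → u ∈ Sunion H M ρ v → w ∈ Sunion H M ρ v := by
    intro u w hwM hadj hu
    by_contra hw
    exact hM.notMem_Sunion_of_adj hinj hfirst hwM hw hadj.symm hu
  have hex : ∀ {u : V}, u ∉ M → u ∉ Sunion H M ρ v →
      ∃ w, H.Adj w u ∧ ρ' w < ρ' u ∧ w ∈ M ∧ w ∉ Sunion H M ρ v := by
    intro u huM hu
    by_contra hcon
    push Not at hcon
    refine hu (mem_Sunion_of_notMem huM fun w hw hwM => ?_)
    by_contra hwS
    exact hwS (hcon w hw.1 ((hout w hwS u hu).1 hw.2) hwM)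
  refine ⟨fun u huv => ?_, Set.Subset.antisymm ?_ ?_⟩
  · by_cases hu : u ∈ Sunion H M ρ v
    · rw [invAt, hM.mem_iff huv]
      refine forall_congr' fun w => forall_congr' fun hadj => ?_
      by_cases hwM : w ∈ M
      · rw [hin w (hno hwM hadj hu) u hu]
      · simp [hwM]
    · constructor
      · intro huM w hadj hlt hwM
        have hw : w ∉ Sunion H M ρ v := hM.notMem_Sunion_of_adj hinj hfirst huM hu hadj
        exact (hM.mem_iff huv).1 huM w hadj ((hout w hw u hu).2 hlt) hwM
      · intro h
        by_contra huM
        obtain ⟨w, hadj, hlt, hwM, -⟩ := hex huM hu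
        exact h w hadj hlt hwM
  · refine Sunion_subset (self_mem_Sunion ..) (fun u huM w hw hwu => ?_) fun u huM h => ?_
    · by_contra hu
      exact hM.notMem_Sunion_of_adj hinj hfirst huM hu hwu.1 hw
    · by_contra hu
      obtain ⟨w, hadj, hlt, hwM, hw⟩ := hex huM hu
      exact hw (h w ⟨hadj, hlt⟩ hwM)
  · have key : ∀ n u, ρ u = n → u ∈ Sunion H M ρ v → u ∈ Sunion H M ρ' v := by
      intro n
      induction n using Nat.strong_induction_on with
      | _ n ih =>
        rintro u rfl hu
        rcases mem_Sunion_cases hu with rfl | ⟨huM, w, hw, hwu⟩ | ⟨huM, h⟩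
        · exact self_mem_Sunion ..
        · exact mem_Sunion_of_mem huM (ih _ hwu.2 w rfl hw)
            ⟨hwu.1, (hin w hw u hu).1 hwu.2⟩
        · refine mem_Sunion_of_notMem huM fun w hw hwM => ?_
          have hwS := hno hwM hw.1 hu
          exact ih _ ((hin w hwS u hu).2 hw.2) w rfl hwS
    exact fun u => key _ u rfl

theorem pushFirst_lt_iff {π : V → ℕ} {v u w : V} (hu : u ≠ v) :
    pushFirst π v w < pushFirst π v u ↔ w = v ∨ π w < π u := by
  by_cases hw : w = v <;> simp [pushFirst, hu, hw]

theorem pushFirst_first (π : V → ℕ) (v : V) : ∀ w ≠ v, pushFirst π v v < pushFirst π v w :=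
  fun _ hw => (pushFirst_lt_iff hw).2 (Or.inl rfl)

theorem not_pushFirst_lt_self (π : V → ℕ) (v w : V) :
    ¬ pushFirst π v w < pushFirst π v v := by
  simp [pushFirst]

theorem pushFirst_injective {π : V → ℕ} (hπ : Function.Injective π) (v : V) :
    Function.Injective (pushFirst π v) := by
  intro x y h
  by_cases hx : x = v <;> by_cases hy : y = v <;> simp_all [pushFirst]
  exact hπ h

theorem sameOrderOn.pushFirst {π σ : V → ℕ} {A : Set V} {v : V}
    (h : sameOrderOn π σ (A \ {v})) : sameOrderOn (pushFirst π v) (pushFirst σ v) A := by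
  intro x hx y hy
  by_cases hyv : y = v
  · subst hyv
    simp [not_pushFirst_lt_self]
  · rw [pushFirst_lt_iff hyv, pushFirst_lt_iff hyv]
    by_cases hxv : x = v
    · simp [hxv]
    · rw [h x ⟨hx, hxv⟩ y ⟨hy, hyv⟩]

/-- When no earlier neighbor of `v` is in `M`, the influenced set is contained in the one for the
order with `v` moved first, and `v` precedes all of the latter. -/
theorem Sunion_subset_pushFirst [Finite V] {H : SimpleGraph V} {M : Set V} {π : V → ℕ} {v : V}
    (hv : ∀ u, H.Adj u v → π u < π v → u ∉ M)
    (hdom : ∀ u ≠ v, u ∉ M → ∃ w ∈ M, w ∈ Iset H π u) :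
    Sunion H M π v ⊆ Sunion H M (pushFirst π v) v ∧
      ∀ u ∈ Sunion H M (pushFirst π v) v, π v ≤ π u := by
  constructor
  · refine Sunion_subset (self_mem_Sunion ..) (fun u huM w hw hwu => ?_) fun u huM h => ?_
    · by_cases huv : u = v
      · exact huv ▸ self_mem_Sunion ..
      · exact mem_Sunion_of_mem huM hw ⟨hwu.1, (pushFirst_lt_iff huv).2 (Or.inr hwu.2)⟩
    · by_cases huv : u = v
      · exact huv ▸ self_mem_Sunion ..
      · refine mem_Sunion_of_notMem huM fun w hw hwM => ?_
        rcases (pushFirst_lt_iff huv).1 hw.2 with rfl | hlt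
        · exact self_mem_Sunion ..
        · exact h w ⟨hw.1, hlt⟩ hwM
  · have key : ∀ n u, π u = n → u ∈ Sunion H M (pushFirst π v) v → π v ≤ π u := by
      intro n
      induction n using Nat.strong_induction_on with
      | _ n ih =>
        rintro u rfl hu
        by_contra! hlt
        have huv : u ≠ v := fun e => by simp [e] at hlt
        rcases mem_Sunion_cases hu with e | ⟨huM, w, hw, hwu⟩ | ⟨huM, h⟩
        · exact huv e
        · rcases (pushFirst_lt_iff huv).1 hwu.2 with rfl | hlt'
          · exact hv u hwu.1.symm hlt huM
          · have := ih _ hlt' w rfl hw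
            omega
        · obtain ⟨w, hwM, hwu⟩ := hdom u huv huM
          have := ih _ hwu.2 w rfl
            (h w ⟨hwu.1, (pushFirst_lt_iff huv).2 (Or.inr hwu.2)⟩ hwM)
          have := hwu.2
          omega
    exact fun u => key _ u rfl

theorem toOrd_injective [Fintype V] (π : V ≃ Fin (Fintype.card V)) :
    Function.Injective (toOrd π) :=
  fun _ _ h => π.injective (Fin.ext h)

/-- If `F` is invariant under exchanging `v` with its successor inside `F π`, then among the orders
with `F π = P` no more have `k` elements of `P` before `v` than have `k + 1`. -/
theorem card_rank_le_card_rank_succ [Fintype V] [DecidableEq V] (v : V)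
    (F : (V ≃ Fin (Fintype.card V)) → Finset V)
    (hswap : ∀ π, ∀ x ∈ F π, π v < π x → (∀ y ∈ F π, ¬ (π v < π y ∧ π y < π x)) →
      F ((Equiv.swap v x).trans π) = F π)
    (P : Finset V) (hvP : v ∈ P) (k : ℕ) (hk : k + 1 < P.card) :
    ({π | F π = P ∧ (P.filter fun y => π y < π v).card = k} :
        Finset (V ≃ Fin (Fintype.card V))).card ≤
      ({π | F π = P ∧ (P.filter fun y => π y < π v).card = k + 1} :
        Finset (V ≃ Fin (Fintype.card V))).card := by
  have hsucc : ∀ π : V ≃ Fin (Fintype.card V), ∃ x, (P.filter fun y => π y < π v).card = k →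
      x ∈ P ∧ π v < π x ∧ ∀ y ∈ P, ¬ (π v < π y ∧ π y < π x) := by
    intro π
    by_cases hc : (P.filter fun y => π y < π v).card = k
    · have hne : (P.filter fun y => π v < π y).Nonempty := by
        by_contra hempty
        rw [Finset.not_nonempty_iff_eq_empty, Finset.filter_eq_empty_iff] at hempty
        have hsub : P.erase v ⊆ P.filter fun y => π y < π v := by
          intro y hy
          rw [Finset.mem_erase] at hy
          exact Finset.mem_filter.2 ⟨hy.2, lt_of_le_of_ne (not_lt.1 (hempty hy.2))
            (π.injective.ne hy.1)⟩
        have := Finset.card_le_card hsub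
        rw [Finset.card_erase_of_mem hvP] at this
        omega
      obtain ⟨x, hx, hmin⟩ := Finset.exists_min_image _ π hne
      rw [Finset.mem_filter] at hx
      exact ⟨x, fun _ => ⟨hx.1, hx.2, fun y hy hlt =>
        absurd hlt.2 (not_lt.2 (hmin y (Finset.mem_filter.2 ⟨hy, hlt.1⟩)))⟩⟩
    · exact ⟨v, fun h => absurd h hc⟩
  choose f hf using hsucc
  refine Finset.card_le_card_of_injOn (fun π => (Equiv.swap v (f π)).trans π) ?_ ?_
  · intro π hπ
    simp only [Finset.coe_filter, Finset.mem_univ, true_and, Set.mem_ofPred_eq] at hπ ⊢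
    obtain ⟨hF, hc⟩ := hπ
    obtain ⟨hx, hlt, hmin⟩ := hf π hc
    have hxv : f π ≠ v := fun e => by simp [e] at hlt
    refine ⟨(hswap π _ (hF ▸ hx) hlt (hF ▸ hmin)).trans hF, ?_⟩
    have heq : (P.filter fun y => ((Equiv.swap v (f π)).trans π) y <
        ((Equiv.swap v (f π)).trans π) v) = insert (f π) (P.filter fun y => π y < π v) := by
      ext y
      simp only [Finset.mem_filter, Finset.mem_insert, Equiv.trans_apply, Equiv.swap_apply_left]
      by_cases hyv : y = v
      · simp [hyv, hxv.symm]
      by_cases hyx : y = f π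
      · simp [hyx, hx, hlt]
      rw [Equiv.swap_apply_of_ne_of_ne hyv hyx]
      simp only [hyx, false_or]
      refine and_congr_right fun hy => ⟨fun h => ?_, fun h => h.trans hlt⟩
      exact lt_of_le_of_ne (not_lt.1 fun h' => hmin y hy ⟨h', h⟩) (π.injective.ne hyv)
    rw [heq, Finset.card_insert_of_notMem, hc]
    simp [hlt.le]
  · intro π hπ σ hσ h
    simp only [Finset.coe_filter, Finset.mem_univ, true_and, Set.mem_ofPred_eq] at hπ hσ h
    have hpred : ∀ τ : V ≃ Fin (Fintype.card V), (P.filter fun y => τ y < τ v).card = k →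
        f τ ∈ P ∧ ((Equiv.swap v (f τ)).trans τ) (f τ) < ((Equiv.swap v (f τ)).trans τ) v ∧
        ∀ y ∈ P, ¬ (((Equiv.swap v (f τ)).trans τ) (f τ) < ((Equiv.swap v (f τ)).trans τ) y ∧
          ((Equiv.swap v (f τ)).trans τ) y < ((Equiv.swap v (f τ)).trans τ) v) := by
      intro τ hc
      obtain ⟨hx, hlt, hmin⟩ := hf τ hc
      simp only [Equiv.trans_apply, Equiv.swap_apply_left, Equiv.swap_apply_right]
      refine ⟨hx, hlt, fun y hy => ?_⟩
      by_cases hyv : y = v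
      · simp [hyv]
      by_cases hyx : y = f τ
      · simp [hyx]
      rw [Equiv.swap_apply_of_ne_of_ne hyv hyx]
      exact hmin y hy
    have hfe : f π = f σ := by
      have h1 := hpred π hπ.2
      have h2 := hpred σ hσ.2
      rw [← h] at h2
      rcases lt_trichotomy (((Equiv.swap v (f π)).trans π) (f π))
          (((Equiv.swap v (f π)).trans π) (f σ)) with hlt | heq | hlt
      · exact absurd ⟨hlt, h2.2.1⟩ (h1.2.2 _ h2.1)
      · exact Equiv.injective _ heq
      · exact absurd ⟨hlt, h1.2.1⟩ (h2.2.2 _ h1.1)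
    rw [← hfe] at h
    ext y
    have := congrArg (fun e : V ≃ Fin (Fintype.card V) => e (Equiv.swap v (f π) y)) h
    simp only [Equiv.trans_apply, Equiv.swap_apply_self] at this
    rw [this]

/-- If `F` is invariant under exchanging `v` with its successor inside `F π`, then the average of
`|F π|` over the orders in which `v` is the first element of `F π` is at most `1`. -/
theorem sum_card_ite_first_le [Fintype V] [DecidableEq V] (v : V)
    (F : (V ≃ Fin (Fintype.card V)) → Finset V) (hv : ∀ π, v ∈ F π)
    (hswap : ∀ π, ∀ x ∈ F π, π v < π x → (∀ y ∈ F π, ¬ (π v < π y ∧ π y < π x)) →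
      F ((Equiv.swap v x).trans π) = F π) :
    ∑ π, (if ∀ u ∈ F π, π v ≤ π u then (F π).card else 0) ≤
      Fintype.card (V ≃ Fin (Fintype.card V)) := by
  have hfib : ∀ P : Finset V,
      ∑ π with F π = P, (if ∀ u ∈ F π, π v ≤ π u then (F π).card else 0) ≤
        ∑ π with F π = P, 1 := by
    intro P
    by_cases hvP : v ∈ P
    · let A : ℕ → Finset (V ≃ Fin (Fintype.card V)) := fun k =>
        {π | F π = P ∧ (P.filter fun y => π y < π v).card = k}
      have hA : ∀ k < P.card, (A 0).card ≤ (A k).card := by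
        intro k
        induction k with
        | zero => exact fun _ => le_rfl
        | succ k ih =>
          exact fun hk =>
            (ih (by omega)).trans (card_rank_le_card_rank_succ v F hswap P hvP k hk)
      have hlhs : ∑ π with F π = P, (if ∀ u ∈ F π, π v ≤ π u then (F π).card else 0) =
          (A 0).card * P.card := by
        rw [← Finset.sum_filter, Finset.filter_filter]
        have hset : (Finset.univ.filter fun π => F π = P ∧ ∀ u ∈ F π, π v ≤ π u) = A 0 := by
          ext π
          simp only [A, Finset.mem_filter, Finset.mem_univ, true_and, Finset.card_eq_zero,
            Finset.filter_eq_empty_iff, not_lt]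
          exact and_congr_right fun h => by rw [h]
        rw [hset, Finset.sum_congr rfl (g := fun _ => P.card), Finset.sum_const, smul_eq_mul]
        intro π hπ
        rw [(Finset.mem_filter.1 hπ).2.1]
      rw [hlhs, Finset.sum_const, smul_eq_mul, mul_one]
      calc (A 0).card * P.card = ∑ _k ∈ Finset.range P.card, (A 0).card := by
            simp [mul_comm]
        _ ≤ ∑ k ∈ Finset.range P.card, (A k).card :=
            Finset.sum_le_sum fun k hk => hA k (Finset.mem_range.1 hk)
        _ = ((Finset.range P.card).biUnion A).card := by
            refine (Finset.card_biUnion fun i _ j _ hij => ?_).symm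
            refine Finset.disjoint_left.2 fun π hi hj => hij ?_
            exact (Finset.mem_filter.1 hi).2.2.symm.trans (Finset.mem_filter.1 hj).2.2
        _ ≤ _ := by
            refine Finset.card_le_card fun π hπ => ?_
            obtain ⟨k, -, hk⟩ := Finset.mem_biUnion.1 hπ
            exact Finset.mem_filter.2 ⟨Finset.mem_univ _, (Finset.mem_filter.1 hk).2.1⟩
    · have hne : ∀ π ∈ Finset.univ, F π ≠ P := fun π _ h => hvP (h ▸ hv π)
      rw [Finset.filter_false_of_mem hne]
      simp
  calc _ = ∑ P : Finset V,
        ∑ π with F π = P, (if ∀ u ∈ F π, π v ≤ π u then (F π).card else 0) :=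
        (Finset.sum_fiberwise _ _ _).symm
    _ ≤ ∑ P : Finset V, ∑ π with F π = P, 1 := Finset.sum_le_sum fun P _ => hfib P
    _ = _ := by
        rw [Finset.sum_fiberwise]
        simp [Finset.card_univ]

/-- Exchanging `v` with its successor `x` inside `A` preserves the order on `A \ {v}`. -/
theorem sameOrderOn_swap [Fintype V] [DecidableEq V] {π : V ≃ Fin (Fintype.card V)} {v x : V}
    {A : Set V} (hlt : π v < π x) (hmin : ∀ y ∈ A, ¬ (π v < π y ∧ π y < π x)) :
    sameOrderOn (toOrd π) (toOrd ((Equiv.swap v x).trans π)) (A \ {v}) := by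
  have hne : ∀ y, y ≠ v → π y ≠ π v := fun y hy => π.injective.ne hy
  have hcmp : ∀ y ∈ A, y ≠ v → (π y < π x ↔ π y < π v) := by
    intro y hy hyv
    refine ⟨fun h => ?_, fun h => h.trans hlt⟩
    exact lt_of_le_of_ne (not_lt.1 fun h' => hmin y hy ⟨h', h⟩) (hne y hyv)
  rintro y ⟨hy, hyv⟩ z ⟨hz, hzv⟩
  simp only [Set.mem_singleton_iff] at hyv hzv
  simp only [toOrd, Fin.val_fin_lt, Equiv.trans_apply]
  by_cases hyx : y = x
  · by_cases hzx : z = x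
    · simp [hyx, hzx]
    · have := hcmp z hz hzv
      have hzx' : π z ≠ π x := π.injective.ne hzx
      have := hne z hzv
      rw [hyx, Equiv.swap_apply_right, Equiv.swap_apply_of_ne_of_ne hzv hzx]
      omega
  · rw [Equiv.swap_apply_of_ne_of_ne hyv hyx]
    by_cases hzx : z = x
    · rw [hzx, Equiv.swap_apply_right]
      exact hcmp y hy hyv
    · rw [Equiv.swap_apply_of_ne_of_ne hzv hzx]

/-- Exchanging two elements outside `A` preserves the order on `A`. -/
theorem sameOrderOn_swap_of_notMem [Fintype V] [DecidableEq V]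
    {π : V ≃ Fin (Fintype.card V)} {v x : V} {A : Set V} (hv : v ∉ A) (hx : x ∉ A) :
    sameOrderOn (toOrd π) (toOrd ((Equiv.swap v x).trans π)) A := by
  intro y hy z hz
  have hne : ∀ {a b : V}, a ∈ A → b ∉ A → a ≠ b := fun ha hb e => hb (e ▸ ha)
  simp only [toOrd, Equiv.trans_apply, Equiv.swap_apply_of_ne_of_ne (hne hy hv) (hne hy hx),
    Equiv.swap_apply_of_ne_of_ne (hne hz hv) (hne hz hx)]

/-- Let `M π` be states satisfying the MIS invariant off `v` when `v` is moved first, with the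
state of `v` fixed. A family of sets that are empty unless `v` comes first in the influenced set
of `M π`, and contained in it in that case, has average size at most `1`. -/
theorem average_ncard_le_one [Fintype V] [DecidableEq V] (H : SimpleGraph V) (v : V)
    (M : (V ≃ Fin (Fintype.card V)) → Set V)
    (hM : ∀ π, invOff H (pushFirst (toOrd π) v) v (M π)) (hconst : ∀ π σ, v ∈ M π ↔ v ∈ M σ)
    (T : (V ≃ Fin (Fintype.card V)) → Set V)
    (hT : ∀ π, T π = ∅ ∨ T π ⊆ Sunion H (M π) (pushFirst (toOrd π) v) v ∧
      ∀ u ∈ Sunion H (M π) (pushFirst (toOrd π) v) v, toOrd π v ≤ toOrd π u) :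
    (∑ π, ((T π).ncard : ℝ)) / (Fintype.card (V ≃ Fin (Fintype.card V)) : ℝ) ≤ 1 := by
  let F : (V ≃ Fin (Fintype.card V)) → Finset V := fun π =>
    (Set.toFinite (Sunion H (M π) (pushFirst (toOrd π) v) v)).toFinset
  have hF : ∀ π, ∀ u, u ∈ F π ↔ u ∈ Sunion H (M π) (pushFirst (toOrd π) v) v := fun π u =>
    Set.Finite.mem_toFinset _
  have hv : ∀ π, v ∈ F π := fun π => (hF π v).2 (self_mem_Sunion ..)
  have hsum := sum_card_ite_first_le v F hv ?_
  · have hle : ∑ π, (T π).ncard ≤ Fintype.card (V ≃ Fin (Fintype.card V)) := by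
      refine le_trans (Finset.sum_le_sum fun π _ => ?_) hsum
      rcases hT π with h | ⟨hsub, hfirst⟩
      · simp [h]
      · have hmin : ∀ u ∈ F π, π v ≤ π u := fun u hu => hfirst u ((hF π u).1 hu)
        rw [if_pos hmin, ← Set.ncard_coe_finset]
        exact Set.ncard_le_ncard (fun u hu => (hF π u).2 (hsub hu)) (Set.toFinite _)
    exact div_le_one_of_le₀ (by exact_mod_cast hle) (by positivity)
  · intro π x hx hlt hmin
    have hre := (hM π).reorder (ρ' := pushFirst (toOrd ((Equiv.swap v x).trans π)) v)
      (pushFirst_injective (toOrd_injective π) v) (pushFirst_first _ v)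
      (sameOrderOn_swap hlt fun y hy => hmin y ((hF π y).2 hy)).pushFirst
      (sameOrderOn_swap_of_notMem (fun h => h.1 ((hF π v).1 (hv π)))
        fun h => h.1 ((hF π x).1 hx)).pushFirst
    have hMeq : M ((Equiv.swap v x).trans π) = M π :=
      (hM _).unique hre.1 (hconst _ _)
    ext u
    rw [hF, hF, hMeq, hre.2]

theorem mem_greedySet {G : SimpleGraph V} {π : V → ℕ} {v : V} :
    v ∈ greedySet G π ↔ ∀ u, G.Adj u v → π u < π v → u ∉ greedySet G π := by
  simp only [greedySet, Set.mem_ofPred_eq]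
  rw [greedy]

theorem exists_mem_greedySet_of_notMem {G : SimpleGraph V} {π : V → ℕ} {u : V}
    (hu : u ∉ greedySet G π) : ∃ w ∈ greedySet G π, w ∈ Iset G π u := by
  rw [mem_greedySet] at hu
  push Not at hu
  obtain ⟨w, hadj, hlt, hw⟩ := hu
  exact ⟨w, hw, hadj, hlt⟩

theorem invOff_greedySet_pushFirst (G : SimpleGraph V) (π : V → ℕ) (v : V) :
    invOff G (pushFirst π v) v (greedySet G (pushFirst π v)) :=
  fun _ _ => mem_greedySet

theorem self_mem_greedySet_pushFirst (G : SimpleGraph V) (π : V → ℕ) (v : V) :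
    v ∈ greedySet G (pushFirst π v) :=
  mem_greedySet.2 fun _ _ h => absurd h (not_pushFirst_lt_self π v _)

/-- Moving a member of the greedy MIS first does not change the greedy MIS. -/
theorem greedySet_pushFirst {G : SimpleGraph V} {π : V → ℕ} (hπ : Function.Injective π) {v : V}
    (hv : v ∈ greedySet G π) : greedySet G (pushFirst π v) = greedySet G π := by
  refine (invOff_greedySet_pushFirst G π v).unique (fun u huv => ?_)
    (by simp [hv, self_mem_greedySet_pushFirst])
  constructor
  · intro hu w hadj hlt hw
    rcases (pushFirst_lt_iff huv).1 hlt with rfl | hlt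
    · rcases lt_trichotomy (π w) (π u) with h | h | h
      · exact mem_greedySet.1 hu w hadj h hw
      · exact hadj.ne (hπ h)
      · exact mem_greedySet.1 hw u hadj.symm h hu
    · exact mem_greedySet.1 hu w hadj hlt hw
  · intro h
    exact mem_greedySet.2 fun w hadj hlt => h w hadj ((pushFirst_lt_iff huv).2 (Or.inr hlt))

theorem invOff_greedySet_diff {G H : SimpleGraph V} {v : V} (π : V → ℕ)
    (hGH : ∀ x y, G.Adj x y ↔ H.Adj x y ∧ x ≠ v ∧ y ≠ v) :
    invOff H (pushFirst π v) v (greedySet G π \ {v}) := by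
  intro u huv
  have hu : u ∈ greedySet G π \ {v} ↔ u ∈ greedySet G π := by simp [huv]
  rw [invAt, hu, mem_greedySet]
  refine forall_congr' fun w => ?_
  rw [hGH, pushFirst_lt_iff huv]
  by_cases hwv : w = v <;> simp [hwv, huv]

/-- For a single node change (deletion or insertion of a node `vs`, modeled on a common
vertex type in which `vs` is isolated in the graph not containing it), the expected size
of the influenced set is at most 1. -/
theorem stmt3 {V : Type*} [Fintype V] [DecidableEq V]
    (Gold Gnew : SimpleGraph V) (vs : V) :
    ((∀ x y, Gnew.Adj x y ↔ Gold.Adj x y ∧ x ≠ vs ∧ y ≠ vs) →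
      (∑ π : V ≃ Fin (Fintype.card V),
          ((Sinfl Gold (greedySet Gold (toOrd π)) (toOrd π) vs
              (vs ∈ greedySet Gold (toOrd π))).ncard : ℝ))
        / (Fintype.card (V ≃ Fin (Fintype.card V)) : ℝ) ≤ 1) ∧
    ((∀ x y, Gold.Adj x y ↔ Gnew.Adj x y ∧ x ≠ vs ∧ y ≠ vs) →
      (∑ π : V ≃ Fin (Fintype.card V),
          ((Sinfl Gnew (greedySet Gold (toOrd π) \ {vs}) (toOrd π) vs
              (¬ ∃ u, Gnew.Adj u vs ∧ toOrd π u < toOrd π vs ∧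
                  u ∈ greedySet Gold (toOrd π) \ {vs})).ncard : ℝ))
        / (Fintype.card (V ≃ Fin (Fintype.card V)) : ℝ) ≤ 1) := by
  refine ⟨fun _ => ?_, fun hG => ?_⟩
  · refine average_ncard_le_one Gold vs
      (fun π => greedySet Gold (pushFirst (toOrd π) vs))
      (fun π => invOff_greedySet_pushFirst Gold _ vs)
      (fun π σ => by simp only [self_mem_greedySet_pushFirst]) _ fun π => ?_
    by_cases hv : vs ∈ greedySet Gold (toOrd π)
    · right
      rw [Sinfl, if_pos hv, greedySet_pushFirst (toOrd_injective π) hv]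
      exact Sunion_subset_pushFirst (mem_greedySet.1 hv)
        fun u _ hu => exists_mem_greedySet_of_notMem hu
    · exact Or.inl (if_neg hv)
  · refine average_ncard_le_one Gnew vs (fun π => greedySet Gold (toOrd π) \ {vs})
      (fun π => invOff_greedySet_diff _ hG) (fun π σ => by simp) _ fun π => ?_
    by_cases hb : ∃ u, Gnew.Adj u vs ∧ toOrd π u < toOrd π vs ∧
        u ∈ greedySet Gold (toOrd π) \ {vs}
    · exact Or.inl (if_neg (not_not.2 hb))
    · right
      rw [Sinfl, if_pos hb]
      refine Sunion_subset_pushFirst (fun u hadj hlt hu => hb ⟨u, hadj, hlt, hu⟩)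
        fun u huv hu => ?_
      obtain ⟨w, hw, hadj, hlt⟩ := exists_mem_greedySet_of_notMem fun h => hu ⟨h, huv⟩
      have hH := (hG w u).1 hadj
      exact ⟨w, ⟨hw, hH.2.1⟩, hH.1, hlt⟩

end
end

section
/- For any of the four topology changes (edge insertion, edge deletion, node deletion, node insertion) and any linear order π: if π(v*) ≠ min{π(u) : u ∈ S'(π)}, then S(G_old,G_new,π) = ∅; and if π(v*) = min{π(u) : u ∈ S'(π)}, then S(G_old,G_new,π) ⊆ S'(π). -/
open scoped Classical

noncomputable section

variable {V : Type*}

/-- Data describing a topology change: the old and new graphs, the graph `HS` in which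
the influenced set `S` is computed, the graph `HSp` in which `S'` is computed,
the distinguished vertices `vs = v*` and `vss = v**`, the states `M` (as a function of
the order), and the condition `broken` under which the invariant fails at `v*`. -/
structure ChangeData (V : Type*) where
  Gold : SimpleGraph V
  Gnew : SimpleGraph V
  HS : SimpleGraph V
  HSp : SimpleGraph V
  vs : V
  vss : V
  M : (V → ℕ) → Set V
  broken : (V → ℕ) → Prop

variable {V : Type*}

/-- Edge insertion between `v*` and `v**`. -/
def IsEdgeIns (c : ChangeData V) : Prop :=
  c.vs ≠ c.vss ∧ ¬ c.Gold.Adj c.vs c.vss ∧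
  (∀ x y, c.Gnew.Adj x y ↔ c.Gold.Adj x y ∨ (x = c.vs ∧ y = c.vss) ∨ (x = c.vss ∧ y = c.vs)) ∧
  c.HS = c.Gnew ∧ c.HSp = c.Gold ∧
  (∀ π, c.M π = greedySet c.Gold π) ∧
  (∀ π, c.broken π ↔ ¬ invAt c.Gnew (c.M π) π c.vs)

/-- Edge deletion between `v*` and `v**`. -/
def IsEdgeDel (c : ChangeData V) : Prop :=
  c.vs ≠ c.vss ∧ c.Gold.Adj c.vs c.vss ∧
  (∀ x y, c.Gnew.Adj x y ↔ c.Gold.Adj x y ∧ ¬ ((x = c.vs ∧ y = c.vss) ∨ (x = c.vss ∧ y = c.vs))) ∧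
  c.HS = c.Gnew ∧ c.HSp = c.Gnew ∧
  (∀ π, c.M π = greedySet c.Gold π) ∧
  (∀ π, c.broken π ↔ ¬ invAt c.Gnew (c.M π) π c.vs)

/-- Deletion of the node `v*` (modeled on a common vertex type: `v*` is isolated in `Gnew`). -/
def IsNodeDel (c : ChangeData V) : Prop :=
  c.vss = c.vs ∧
  (∀ x y, c.Gnew.Adj x y ↔ c.Gold.Adj x y ∧ x ≠ c.vs ∧ y ≠ c.vs) ∧
  c.HS = c.Gold ∧ c.HSp = c.Gold ∧
  (∀ π, c.M π = greedySet c.Gold π) ∧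
  (∀ π, c.broken π ↔ c.vs ∈ c.M π)

/-- Insertion of the node `v*` (modeled on a common vertex type: `v*` is isolated in `Gold`). -/
def IsNodeIns (c : ChangeData V) : Prop :=
  c.vss = c.vs ∧
  (∀ x y, c.Gold.Adj x y ↔ c.Gnew.Adj x y ∧ x ≠ c.vs ∧ y ≠ c.vs) ∧
  c.HS = c.Gnew ∧ c.HSp = c.Gnew ∧
  (∀ π, c.M π = greedySet c.Gold π \ {c.vs}) ∧
  (∀ π, c.broken π ↔ ¬ ∃ u, c.Gnew.Adj u c.vs ∧ π u < π c.vs ∧ u ∈ c.M π)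

/-- One of the four topology changes. -/
def IsTopoChange (c : ChangeData V) : Prop :=
  IsEdgeIns c ∨ IsEdgeDel c ∨ IsNodeDel c ∨ IsNodeIns c

/-- The influenced set `S(G_old, G_new, π)`. -/
def Sset (c : ChangeData V) (π : V → ℕ) : Set V :=
  Sinfl c.HS (c.M π) π c.vs (c.broken π)

/-- The set `S'(G_old, G_new, τ, v*)`: same recursion, from `v*` always, in the graph `HSp`,
with `v*` moved to be first in the order, and states given by `M(G_old, τ)`. -/
def Spset (c : ChangeData V) (τ : V → ℕ) : Set V :=
  ⋃ i, Slayer c.HSp (c.M τ) (pushFirst τ c.vs) c.vs i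


theorem mem_greedySet_iff (G : SimpleGraph V) (π : V → ℕ) (v : V) :
    v ∈ greedySet G π ↔ ∀ u, G.Adj u v → π u < π v → u ∉ greedySet G π := by
  change greedy G π v ↔ _
  rw [greedy]
  rfl

theorem pushFirst_lt_pushFirst {π : V → ℕ} {v0 w u : V} (hu : u ≠ v0) (h : π w < π u) :
    pushFirst π v0 w < pushFirst π v0 u := by
  unfold pushFirst
  rw [if_neg hu]
  split_ifs <;> omega

theorem lt_of_pushFirst_lt_pushFirst {π : V → ℕ} {v0 w u : V} (hw : w ≠ v0)
    (h : pushFirst π v0 w < pushFirst π v0 u) : π w < π u := by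
  unfold pushFirst at h
  rw [if_neg hw] at h
  split_ifs at h <;> omega

/-- Moving `v0` to the front of the order does not delay the layer in which a vertex appears. -/
theorem exists_mem_Slayer_pushFirst {H H' : SimpleGraph V} {M : Set V} {π : V → ℕ} {v0 : V}
    (hle : H' ≤ H) (hadj : ∀ w u, u ≠ v0 → π w < π u → H.Adj w u → H'.Adj w u) (i : ℕ) :
    ∀ u ∈ Slayer H M π v0 i, ∃ j ≤ i, u ∈ Slayer H' M (pushFirst π v0) v0 j := by
  induction i using Nat.strong_induction_on with
  | _ i ih =>
    intro u hu
    by_cases huv : u = v0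
    · exact ⟨0, i.zero_le, by rw [Slayer]; exact huv⟩
    cases i with
    | zero => rw [Slayer] at hu; exact absurd hu huv
    | succ i =>
      rw [Slayer] at hu
      rcases hu with ⟨huM, w, hw, hwadj, hwlt⟩ | ⟨huM, hu⟩
      · obtain ⟨j, hj, hwj⟩ := ih i i.lt_succ_self w hw
        refine ⟨j + 1, by omega, ?_⟩
        rw [Slayer]
        exact Or.inl ⟨huM, w, hwj, hadj w u huv hwlt hwadj, pushFirst_lt_pushFirst huv hwlt⟩
      · refine ⟨i + 1, le_rfl, ?_⟩
        rw [Slayer]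
        refine Or.inr ⟨huM, ?_⟩
        rintro w ⟨hwadj, hwlt⟩ hwM
        by_cases hwv : w = v0
        · exact ⟨0, i.zero_le, by rw [Slayer]; exact hwv⟩
        obtain ⟨j, hj, hwj⟩ := hu w ⟨hle hwadj, lt_of_pushFirst_lt_pushFirst hwv hwlt⟩ hwM
        obtain ⟨k, hk, hwk⟩ := ih j (by omega) w hwj
        exact ⟨k, by omega, hwk⟩

/-- If all selected neighbors of `v0` follow it, and every other unselected vertex has an earlier
selected neighbor, then the recursion started at `v0` only reaches vertices after `v0`. -/
theorem le_of_mem_Slayer_pushFirst {H : SimpleGraph V} {M : Set V} {π : V → ℕ} {v0 : V}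
    (hM : ∀ u ∈ M, H.Adj v0 u → π v0 ≤ π u)
    (hdom : ∀ u ∉ M, u ≠ v0 → ∃ w ∈ M, H.Adj w u ∧ π w < π u) (i : ℕ) :
    ∀ u ∈ Slayer H M (pushFirst π v0) v0 i, π v0 ≤ π u := by
  induction i using Nat.strong_induction_on with
  | _ i ih =>
    intro u hu
    by_cases huv : u = v0
    · rw [huv]
    cases i with
    | zero => rw [Slayer] at hu; exact absurd hu huv
    | succ i =>
      rw [Slayer] at hu
      rcases hu with ⟨huM, w, hw, hwadj, hwlt⟩ | ⟨huM, hu⟩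
      · by_cases hwv : w = v0
        · exact hM u huM (hwv ▸ hwadj)
        · exact (ih i i.lt_succ_self w hw).trans (lt_of_pushFirst_lt_pushFirst hwv hwlt).le
      · obtain ⟨w, hwM, hwadj, hwlt⟩ := hdom u huM huv
        obtain ⟨j, hj, hwj⟩ := hu w ⟨hwadj, pushFirst_lt_pushFirst huv hwlt⟩ hwM
        exact (ih j (by omega) w hwj).trans hwlt.le

theorem exists_adj_lt_of_notMem_greedySet {G : SimpleGraph V} {π : V → ℕ} {u : V}
    (hu : u ∉ greedySet G π) : ∃ w ∈ greedySet G π, G.Adj w u ∧ π w < π u := by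
  rw [mem_greedySet_iff] at hu
  push Not at hu
  obtain ⟨w, hadj, hlt, hw⟩ := hu
  exact ⟨w, hw, hadj, hlt⟩

theorem not_adj_of_mem_greedySet {G : SimpleGraph V} {π : V → ℕ} (hπ : Function.Injective π)
    {u v : V} (hu : u ∈ greedySet G π) (hv : v ∈ greedySet G π) : ¬ G.Adj u v := by
  intro h
  rcases lt_trichotomy (π u) (π v) with hlt | heq | hlt
  · exact (mem_greedySet_iff G π v).1 hv u h hlt hu
  · exact h.ne (hπ heq)
  · exact (mem_greedySet_iff G π u).1 hu v h.symm hlt hv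

theorem IsTopoChange.HSp_le_HS {c : ChangeData V} (hc : IsTopoChange c) : c.HSp ≤ c.HS := by
  rcases hc with ⟨-, -, hG, hS, hSp, -⟩ | ⟨-, -, -, hS, hSp, -⟩ | ⟨-, -, hS, hSp, -⟩ |
    ⟨-, -, hS, hSp, -⟩ <;> rw [hS, hSp]
  exact fun x y h => (hG x y).2 (Or.inl h)

theorem IsTopoChange.HSp_adj_of_lt {c : ChangeData V} (hc : IsTopoChange c) {π : V → ℕ}
    (hord : π c.vss ≤ π c.vs) (w u : V) (hu : u ≠ c.vs) (hlt : π w < π u)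
    (h : c.HS.Adj w u) : c.HSp.Adj w u := by
  rcases hc with ⟨-, -, hG, hS, hSp, -⟩ | ⟨-, -, -, hS, hSp, -⟩ | ⟨-, -, hS, hSp, -⟩ |
    ⟨-, -, hS, hSp, -⟩ <;> rw [hS] at h <;> rw [hSp]
  on_goal 1 =>
    rcases (hG w u).1 h with h | ⟨rfl, rfl⟩ | ⟨-, h⟩
    · exact h
    · omega
    · exact absurd h hu
  all_goals exact h

theorem IsTopoChange.le_of_mem_Spset {c : ChangeData V} (hc : IsTopoChange c) {π : V → ℕ}
    (hπ : Function.Injective π) (hb : c.broken π) {u : V} (hu : u ∈ Spset c π) :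
    π c.vs ≤ π u := by
  obtain ⟨i, hi⟩ := Set.mem_iUnion.1 hu
  refine le_of_mem_Slayer_pushFirst ?_ ?_ i u hi
  · intro x hx hadj
    rcases hc with ⟨-, -, hG, -, hSp, hM, hbr⟩ | ⟨-, -, hG, -, hSp, hM, hbr⟩ |
      ⟨-, -, -, hSp, hM, hbr⟩ | ⟨-, hG, -, hSp, hM, hbr⟩ <;> rw [hSp] at hadj <;>
      rw [hM] at hx <;> rw [hbr] at hb
    · rw [hM] at hb
      have hv : c.vs ∈ greedySet c.Gold π := by
        by_contra hv
        obtain ⟨w, hw, hwadj, hlt⟩ := exists_adj_lt_of_notMem_greedySet hv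
        exact hb ⟨fun h => absurd h hv,
          fun h => absurd hw (h w ((hG _ _).2 (Or.inl hwadj)) hlt)⟩
      exact absurd hadj (not_adj_of_mem_greedySet hπ hv hx)
    · rw [hM] at hb
      by_contra! hlt
      have hv : c.vs ∉ greedySet c.Gold π := fun hv =>
        not_adj_of_mem_greedySet hπ hv hx ((hG _ _).1 hadj).1
      exact hb ⟨fun h => absurd h hv, fun h => absurd hx (h x hadj.symm hlt)⟩
    · rw [hM] at hb
      exact absurd hadj (not_adj_of_mem_greedySet hπ hb hx)
    · by_contra! hlt
      exact hb ⟨x, hadj.symm, hlt, by rw [hM]; exact hx⟩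
  · intro x hx hxv
    rcases hc with ⟨-, -, -, -, hSp, hM, -⟩ | ⟨-, -, hG, -, hSp, hM, hbr⟩ |
      ⟨-, -, -, hSp, hM, -⟩ | ⟨-, hG, -, hSp, hM, -⟩ <;> rw [hSp, hM] <;> rw [hM] at hx
    · exact exists_adj_lt_of_notMem_greedySet hx
    · obtain ⟨w, hw, hadj, hlt⟩ := exists_adj_lt_of_notMem_greedySet hx
      refine ⟨w, hw, (hG w x).2 ⟨hadj, ?_⟩, hlt⟩
      rintro (⟨rfl, -⟩ | ⟨-, h⟩)
      · rw [hbr, hM] at hb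
        exact hb ⟨fun _ y hy hlt =>
          (mem_greedySet_iff _ _ _).1 hw y ((hG _ _).1 hy).1 hlt, fun _ => hw⟩
      · exact hxv h
    · exact exists_adj_lt_of_notMem_greedySet hx
    · obtain ⟨w, hw, hadj, hlt⟩ :=
        exists_adj_lt_of_notMem_greedySet fun h => hx ⟨h, hxv⟩
      obtain ⟨hadj, hwv, -⟩ := (hG w x).1 hadj
      exact ⟨w, ⟨hw, hwv⟩, hadj, hlt⟩

/-- If `π(v*)` is not minimal in `S'(π)` then `S = ∅`; if it is minimal then `S ⊆ S'(π)`. -/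
theorem stmt4 {V : Type*} [Fintype V] (c : ChangeData V) (hc : IsTopoChange c)
    (π : V → ℕ) (hπ : Function.Injective π) (hord : π c.vss ≤ π c.vs) :
    ((∃ u ∈ Spset c π, π u < π c.vs) → Sset c π = ∅) ∧
    ((∀ u ∈ Spset c π, π c.vs ≤ π u) → Sset c π ⊆ Spset c π) := by
  constructor
  · rintro ⟨u, hu, hlt⟩
    exact if_neg fun hb => (hc.le_of_mem_Spset hπ hb hu).not_gt hlt
  · intro _ u hu
    unfold Sset Sinfl at hu
    split_ifs at hu
    · obtain ⟨i, hi⟩ := Set.mem_iUnion.1 hu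
      obtain ⟨j, -, hj⟩ :=
        exists_mem_Slayer_pushFirst hc.HSp_le_HS (hc.HSp_adj_of_lt hord) i u hi
      exact Set.mem_iUnion.2 ⟨j, hj⟩
    · exact absurd hu (Set.notMem_empty u)

end
end
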